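/- For all integers m, n ≥ 0, the multiple zeta value ζ({ {2}^m, 1, {2}^m, 3 }^n, {2}^m) is a rational multiple of π^{4n + 2m(2n+1)}: there exists q ∈ ℚ such that ζ({ {2}^m, 1, {2}^m, 3 }^n, {2}^m) = q · π^{4n + 2m(2n+1)}. -/

import Mathlib

/-- The multiple zeta value `ζ(s₁, …, s_k) = ∑_{0 < n₁ < ⋯ < n_k} n₁^{-s₁} ⋯ n_k^{-s_k}`,
defined as a `tsum` over strictly increasing tuples of positive integers.
For the empty tuple this gives `ζ() = 1`. -/
noncomputable def MZV (s : List ℕ) : ℝ :=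
  ∑' f : { f : Fin s.length → ℕ+ // StrictMono f },
    ∏ i : Fin s.length, (((f.1 i : ℕ) : ℝ) ^ (s.get i))⁻¹

open Finset MeasureTheory
open scoped ENNReal

/-- The tail of a multiple zeta value, over tuples of integers exceeding `N`. -/
noncomputable def mzvTail (l : List ℕ) (N : ℕ) : ℝ≥0∞ :=
  ∑' f : Fin l.length → ℕ+, {f : Fin l.length → ℕ+ | StrictMono f ∧ ∀ i, N < f i}.indicator
    (fun f ↦ ∏ i, (((f i : ℕ) : ℝ≥0∞) ^ l.get i)⁻¹) f

/-- The coefficients obtained by appending the exponent `s` to a nested sum. -/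
noncomputable def nextCoeff (s : ℕ) (a : ℕ → ℝ≥0∞) (n : ℕ) : ℝ≥0∞ :=
  ((n : ℝ≥0∞) ^ s)⁻¹ * ∑ k ∈ range n, a k

lemma MZV_eq_toReal (l : List ℕ) : MZV l = (mzvTail l 0).toReal := by
  have h : mzvTail l 0 = ∑' f : { f : Fin l.length → ℕ+ // StrictMono f },
      ∏ i, (((f.1 i : ℕ) : ℝ≥0∞) ^ l.get i)⁻¹ := by
    have : {f : Fin l.length → ℕ+ | StrictMono f ∧ ∀ i, 0 < (f i : ℕ)} =
        {f | StrictMono f} := by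
      ext f; simp
    unfold mzvTail
    rw [this]
    exact (tsum_subtype {f : Fin l.length → ℕ+ | StrictMono f}
      (fun f ↦ ∏ i, (((f i : ℕ) : ℝ≥0∞) ^ l.get i)⁻¹)).symm
  rw [h, MZV, ENNReal.tsum_toReal_eq]
  · simp [ENNReal.toReal_prod]
  · intro f
    refine ENNReal.prod_ne_top fun i _ ↦ ?_
    simp

lemma mzvTail_nil (N : ℕ) : mzvTail [] N = 1 := by
  unfold mzvTail
  rw [tsum_eq_single (fun i => i.elim0)]
  · rw [Set.indicator_of_mem]
    · simp
    · exact ⟨fun i => i.elim0, fun i => i.elim0⟩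
  · intro f hf
    exact absurd (funext fun i => i.elim0) hf

lemma mzvTail_cons (s : ℕ) (l : List ℕ) (N : ℕ) :
    mzvTail (s :: l) N =
      ∑' p : ℕ, {p | N < p}.indicator (fun p ↦ ((p : ℝ≥0∞) ^ s)⁻¹ * mzvTail l p) p := by
  rw [← PNat.coe_injective.tsum_eq]
  · unfold mzvTail
    refine ((Fin.consEquiv (fun _ : Fin (l.length + 1) => ℕ+)).tsum_eq _).symm.trans ?_
    refine ENNReal.tsum_prod'.trans ?_
    refine tsum_congr fun p ↦ ?_
    by_cases hp : N < p
    · rw [Set.indicator_of_mem (by exact hp), ← ENNReal.tsum_mul_left]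
      refine tsum_congr fun f ↦ ?_
      have key : ((Fin.consEquiv (fun _ : Fin (l.length + 1) => ℕ+)) (p, f) ∈
          {f : Fin (l.length + 1) → ℕ+ | StrictMono f ∧ ∀ i, N < f i}) ↔
          f ∈ {f : Fin l.length → ℕ+ | StrictMono f ∧ ∀ i, (p : ℕ) < f i} := by
        simp only [Set.mem_ofPred_eq, Fin.consEquiv_apply, Fin.forall_fin_succ, Fin.cons_zero,
          Fin.cons_succ, StrictMono, PNat.coe_lt_coe]
        simp only [Fin.succ_lt_succ_iff, Fin.succ_pos, forall_const, lt_irrefl, Fin.not_lt_zero,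
          false_imp_iff, true_and]
        constructor
        · tauto
        · rintro ⟨h1, h2⟩
          exact ⟨⟨h2, h1⟩, hp, fun i => hp.trans (h2 i)⟩
      by_cases hf : f ∈ {f : Fin l.length → ℕ+ | StrictMono f ∧ ∀ i, (p : ℕ) < f i}
      · rw [Set.indicator_of_mem hf]
        erw [Set.indicator_of_mem (key.2 hf)]
        erw [Fin.prod_univ_succ]
        rfl
      · rw [Set.indicator_of_notMem hf]
        erw [Set.indicator_of_notMem (fun h => hf (key.1 h))]
        simp
    · rw [Set.indicator_of_notMem (by exact hp), ENNReal.tsum_eq_zero]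
      intro f
      apply Set.indicator_of_notMem
      rintro ⟨-, h⟩
      exact hp (h 0)
  · intro p hp
    have : N < p := by
      by_contra h
      exact hp (Set.indicator_of_notMem h _)
    exact ⟨⟨p, by omega⟩, rfl⟩

lemma tsum_nextCoeff_mul_mzvTail (s : ℕ) (l : List ℕ) (a : ℕ → ℝ≥0∞) :
    ∑' p, nextCoeff s a p * mzvTail l p = ∑' N, a N * mzvTail (s :: l) N := by
  simp_rw [mzvTail_cons, ← ENNReal.tsum_mul_left]
  rw [ENNReal.tsum_comm]
  refine tsum_congr fun p ↦ ?_
  rw [nextCoeff, mul_assoc, mul_left_comm, sum_mul, tsum_eq_sum (s := range p)]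
  · refine sum_congr rfl fun N hN ↦ ?_
    rw [Set.indicator_of_mem (by simpa using hN)]
  · intro N hN
    rw [Set.indicator_of_notMem (by simpa using hN), mul_zero]

lemma tsum_foldl_nextCoeff (l : List ℕ) (a : ℕ → ℝ≥0∞) :
    ∑' p, l.foldl (fun a s ↦ nextCoeff s a) a p = ∑' N, a N * mzvTail l N := by
  induction l generalizing a with
  | nil => simp [mzvTail_nil]
  | cons s l ih => rw [List.foldl_cons, ih, tsum_nextCoeff_mul_mzvTail]

lemma mzvTail_zero_eq (l : List ℕ) :
    mzvTail l 0 = ∑' p, l.foldl (fun a s ↦ nextCoeff s a) (Pi.single 0 1) p := by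
  rw [tsum_foldl_nextCoeff, tsum_eq_single 0]
  · simp
  · intro n hn
    simp [hn]

/-- The kernel `4 ^ n / (2n choose n) * sin (θ / 2) ^ (2 n)`. -/
noncomputable def sinKernel (n : ℕ) (θ : ℝ) : ℝ :=
  4 ^ n / n.centralBinom * Real.sin (θ / 2) ^ (2 * n)

/-- The binomial transform of the sequence `a`. -/
noncomputable def sinGen (a : ℕ → ℝ≥0∞) (θ : ℝ) : ℝ≥0∞ :=
  ∑' n, a n * ENNReal.ofReal (sinKernel n θ)

lemma sinKernel_nonneg (n : ℕ) (θ : ℝ) : 0 ≤ sinKernel n θ :=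
  mul_nonneg (by positivity) (Even.pow_nonneg (even_two_mul n) _)

@[fun_prop]
lemma continuous_sinKernel (n : ℕ) : Continuous (sinKernel n) := by
  unfold sinKernel; fun_prop

lemma measurable_ofReal_sinKernel (n : ℕ) :
    Measurable fun θ ↦ ENNReal.ofReal (sinKernel n θ) :=
  (continuous_sinKernel n).measurable.ennreal_ofReal

lemma four_pow_div_centralBinom_succ (n : ℕ) :
    (4 ^ (n + 1) / (n + 1).centralBinom : ℝ) * (2 * n + 1) =
      2 * (n + 1) * (4 ^ n / n.centralBinom) := by
  have h : ((n : ℝ) + 1) * (n + 1).centralBinom = 2 * (2 * n + 1) * n.centralBinom := by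
    exact_mod_cast Nat.succ_mul_centralBinom_succ n
  have h0 : (n.centralBinom : ℝ) ≠ 0 := by exact_mod_cast n.centralBinom_ne_zero
  have h1 : ((n + 1).centralBinom : ℝ) ≠ 0 := by exact_mod_cast (n + 1).centralBinom_ne_zero
  field_simp
  rw [pow_succ]
  linear_combination (-2 * 4 ^ n : ℝ) * h

lemma integral_sinKernel_sub (n : ℕ) (θ : ℝ) :
    (∫ φ in 0..θ, sinKernel n φ) - ∫ φ in 0..θ, sinKernel (n + 1) φ =
      4 ^ (n + 1) / (n + 1).centralBinom / (n + 1) *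
        (Real.cos (θ / 2) * Real.sin (θ / 2) ^ (2 * n + 1)) := by
  rw [← intervalIntegral.integral_sub ((continuous_sinKernel n).intervalIntegrable _ _)
    ((continuous_sinKernel _).intervalIntegrable _ _),
    intervalIntegral.integral_eq_sub_of_hasDerivAt (f := fun θ ↦
      4 ^ (n + 1) / (n + 1).centralBinom / (n + 1) *
        (Real.cos (θ / 2) * Real.sin (θ / 2) ^ (2 * n + 1)))]
  · simp
  · intro x _
    have h2 : HasDerivAt (fun y : ℝ ↦ y / 2) (1 / 2) x := (hasDerivAt_id x).div_const 2
    have := ((h2.cos.mul (h2.sin.pow (2 * n + 1))).const_mul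
      ((4 ^ (n + 1) / (n + 1).centralBinom / (n + 1) : ℝ)))
    refine this.congr_deriv ?_
    have hb := four_pow_div_centralBinom_succ n
    have hc : (4 ^ n / n.centralBinom : ℝ) =
        4 ^ (n + 1) / (n + 1).centralBinom / (n + 1) * ((2 * n + 1) / 2) := by
      field_simp at hb ⊢
      linear_combination -hb
    have hs := Real.cos_sq' (x / 2)
    have hn : (4 ^ (n + 1) / (n + 1).centralBinom : ℝ) =
      4 ^ (n + 1) / (n + 1).centralBinom / (n + 1) * (n + 1) := by field_simp
    simp only [Pi.pow_apply, Nat.add_sub_cancel, sinKernel]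
    push_cast
    linear_combination (4 ^ (n + 1) / (n + 1).centralBinom / (n + 1) * (2 * n + 1) / 2 *
      Real.sin (x / 2) ^ (2 * n) : ℝ) * hs - Real.sin (x / 2) ^ (2 * n) * hc +
      Real.sin (x / 2) ^ (2 * n + 2) * hn
  · exact ((continuous_sinKernel n).sub (continuous_sinKernel _)).intervalIntegrable _ _

lemma integral_sinKernel_pi (n : ℕ) : ∫ φ in 0..Real.pi, sinKernel n φ = Real.pi := by
  induction n with
  | zero => simp [sinKernel]
  | succ n ih =>
    have := integral_sinKernel_sub n Real.pi
    rw [Real.cos_pi_div_two] at this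
    linarith

lemma integral_sinKernel_nonneg (n : ℕ) {θ : ℝ} (h : 0 ≤ θ) :
    0 ≤ ∫ φ in 0..θ, sinKernel n φ :=
  intervalIntegral.integral_nonneg h fun _ _ ↦ sinKernel_nonneg n _

lemma tendsto_integral_sinKernel {θ : ℝ} (h0 : 0 < θ) (hpi : θ < Real.pi) :
    Filter.Tendsto (fun n ↦ ∫ φ in 0..θ, sinKernel n φ) Filter.atTop (nhds 0) := by
  set s := Real.sin (θ / 2) with hs
  have hs0 : 0 < s := Real.sin_pos_of_pos_of_lt_pi (by linarith) (by linarith)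
  have hs1 : s < 1 := by
    rw [hs, ← Real.sin_pi_div_two]
    exact Real.sin_lt_sin_of_lt_of_le_pi_div_two (by linarith) le_rfl (by linarith)
  have lim := ((tendsto_self_mul_const_pow_of_lt_one (r := s ^ 2) (by positivity)
    (by nlinarith)).const_mul (2 * θ))
  rw [mul_zero] at lim
  refine squeeze_zero' (.of_forall fun n ↦ integral_sinKernel_nonneg n h0.le) ?_ lim
  filter_upwards [Filter.eventually_gt_atTop 0] with n hn
  have hb : (4 ^ n / n.centralBinom : ℝ) ≤ 2 * n := by
    rw [div_le_iff₀ (by exact_mod_cast n.centralBinom_pos)]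
    exact_mod_cast Nat.four_pow_le_two_mul_self_mul_centralBinom n hn
  have hle : ∀ φ ∈ Set.Icc 0 θ, sinKernel n φ ≤ 2 * n * (s ^ 2) ^ n := by
    intro φ hφ
    rw [sinKernel, pow_mul]
    have h1 : 0 ≤ Real.sin (φ / 2) :=
      Real.sin_nonneg_of_nonneg_of_le_pi (by linarith [hφ.1]) (by linarith [hφ.2])
    have h2 : Real.sin (φ / 2) ≤ s :=
      Real.sin_le_sin_of_le_of_le_pi_div_two (by linarith [hφ.1]) (by linarith) (by linarith [hφ.2])
    gcongr
  calc ∫ φ in 0..θ, sinKernel n φ ≤ ∫ _ in 0..θ, 2 * n * (s ^ 2) ^ n :=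
        intervalIntegral.integral_mono_on h0.le ((continuous_sinKernel n).intervalIntegrable _ _)
          (by simp) hle
    _ = 2 * θ * (n * (s ^ 2) ^ n) := by
        rw [intervalIntegral.integral_const, smul_eq_mul]; ring

lemma hasSum_sinKernel_div {θ : ℝ} (h0 : 0 < θ) (hpi : θ < Real.pi) (m : ℕ) :
    HasSum (fun j ↦ sinKernel (j + (m + 1)) θ / ((j + (m + 1) : ℕ) : ℝ))
      (Real.tan (θ / 2) * ∫ φ in 0..θ, sinKernel m φ) := by
  rw [hasSum_iff_tendsto_nat_of_nonneg fun j ↦ div_nonneg (sinKernel_nonneg _ _) (by positivity)]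
  have hc : Real.cos (θ / 2) ≠ 0 :=
    (Real.cos_pos_of_mem_Ioo ⟨by linarith, by linarith⟩).ne'
  have key : ∀ J, ∑ j ∈ range J, sinKernel (j + (m + 1)) θ / ((j + (m + 1) : ℕ) : ℝ) =
      Real.tan (θ / 2) * ((∫ φ in 0..θ, sinKernel m φ) - ∫ φ in 0..θ, sinKernel (J + m) φ) := by
    intro J
    induction J with
    | zero => simp
    | succ J ih =>
      have := integral_sinKernel_sub (J + m) θ
      rw [sum_range_succ, ih, show J + 1 + m = J + m + 1 by ring]
      rw [sub_eq_iff_eq_add] at this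
      rw [this, sinKernel, Real.tan_eq_sin_div_cos, show J + (m + 1) = J + m + 1 by ring]
      push_cast
      field_simp
      ring
  simp_rw [key]
  have := (tendsto_integral_sinKernel h0 hpi).comp (Filter.tendsto_add_atTop_nat m)
  simpa using (this.const_sub (∫ φ in 0..θ, sinKernel m φ)).const_mul (Real.tan (θ / 2))

lemma setLIntegral_Ioo_ofReal {f : ℝ → ℝ} (hf : Continuous f) {θ : ℝ} (h0 : 0 ≤ θ)
    (hn : ∀ x ∈ Set.Ioo 0 θ, 0 ≤ f x) :
    ∫⁻ φ in Set.Ioo 0 θ, ENNReal.ofReal (f φ) = ENNReal.ofReal (∫ φ in 0..θ, f φ) := by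
  rw [intervalIntegral.integral_of_le h0, integral_Ioc_eq_integral_Ioo,
    ofReal_integral_eq_lintegral_ofReal]
  · exact (hf.integrableOn_Icc).mono_set Set.Ioo_subset_Icc_self
  · exact (ae_restrict_iff' measurableSet_Ioo).2 (Filter.Eventually.of_forall hn)

lemma lintegral_sinGen (a : ℕ → ℝ≥0∞) {θ : ℝ} (h0 : 0 ≤ θ) :
    ∫⁻ φ in Set.Ioo 0 θ, sinGen a φ =
      ∑' n, a n * ENNReal.ofReal (∫ φ in 0..θ, sinKernel n φ) := by
  unfold sinGen
  rw [lintegral_tsum fun n ↦ ((measurable_ofReal_sinKernel n).const_mul _).aemeasurable]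
  refine tsum_congr fun n ↦ ?_
  rw [lintegral_const_mul _ (measurable_ofReal_sinKernel n),
    setLIntegral_Ioo_ofReal (continuous_sinKernel n) h0 fun _ _ ↦ sinKernel_nonneg n _]

lemma lintegral_sinGen_pi (a : ℕ → ℝ≥0∞) :
    ∫⁻ φ in Set.Ioo 0 Real.pi, sinGen a φ = (∑' n, a n) * ENNReal.ofReal Real.pi := by
  rw [lintegral_sinGen a Real.pi_pos.le, ← ENNReal.tsum_mul_right]
  simp_rw [integral_sinKernel_pi]

lemma sinGen_nextCoeff_one (a : ℕ → ℝ≥0∞) {θ : ℝ} (h : θ ∈ Set.Ioo 0 Real.pi) :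
    sinGen (nextCoeff 1 a) θ =
      ENNReal.ofReal (Real.tan (θ / 2)) * ∫⁻ φ in Set.Ioo 0 θ, sinGen a φ := by
  have h1 : ∀ n, nextCoeff 1 a n * ENNReal.ofReal (sinKernel n θ) =
      ∑' k, {k | k < n}.indicator
        (fun k ↦ a k * ENNReal.ofReal (sinKernel n θ / n)) k := by
    intro n
    rw [tsum_eq_sum (s := range n) (fun k hk ↦ Set.indicator_of_notMem (by simpa using hk) _)]
    rw [sum_congr rfl fun k hk ↦ Set.indicator_of_mem (by simpa using hk) _, ← sum_mul,
      nextCoeff, pow_one, mul_assoc, mul_left_comm]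
    rcases n.eq_zero_or_pos with rfl | hn
    · simp
    · rw [ENNReal.ofReal_div_of_pos (by exact_mod_cast hn), ENNReal.ofReal_natCast,
        ENNReal.div_eq_inv_mul]
  rw [lintegral_sinGen a h.1.le, sinGen, ← ENNReal.tsum_mul_left]
  simp_rw [h1]
  rw [ENNReal.tsum_comm]
  refine tsum_congr fun k ↦ ?_
  have h2 := hasSum_sinKernel_div h.1 h.2 k
  rw [mul_left_comm, ← ENNReal.ofReal_mul (Real.tan_nonneg_of_nonneg_of_le_pi_div_two
    (by linarith [h.1]) (by linarith [h.2])), ← h2.tsum_eq,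
    ENNReal.ofReal_tsum_of_nonneg (fun j ↦ div_nonneg (sinKernel_nonneg _ _) (by positivity))
      h2.summable, ← ENNReal.tsum_mul_left]
  refine (ENNReal.summable.sum_add_tsum_nat_add' (k := k + 1)).symm.trans ?_
  rw [sum_eq_zero, zero_add]
  · refine tsum_congr fun j ↦ ?_
    rw [Set.indicator_of_mem (by simp; omega)]
  · intro n hn
    rw [Set.indicator_of_notMem (by simp at hn ⊢; omega)]

/-- Termwise division of a sequence by its index. -/
noncomputable def divCoeff (a : ℕ → ℝ≥0∞) (n : ℕ) : ℝ≥0∞ := (n : ℝ≥0∞)⁻¹ * a n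

lemma nextCoeff_succ (s : ℕ) (a : ℕ → ℝ≥0∞) :
    nextCoeff (s + 1) a = divCoeff (nextCoeff s a) := by
  funext n
  rcases n.eq_zero_or_pos with rfl | hn
  · simp [nextCoeff, divCoeff]
  · rw [nextCoeff, divCoeff, nextCoeff, pow_succ', ENNReal.mul_inv (by simp) (by simp), mul_assoc]

lemma lintegral_cot_mul_sinKernel {n : ℕ} (hn : n ≠ 0) {θ : ℝ} (h0 : 0 ≤ θ)
    (hpi : θ ≤ Real.pi) :
    ∫⁻ φ in Set.Ioo 0 θ, ENNReal.ofReal (Real.cot (φ / 2)) * ENNReal.ofReal (sinKernel n φ) =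
      ENNReal.ofReal (sinKernel n θ / n) := by
  obtain ⟨n, rfl⟩ := Nat.exists_eq_succ_of_ne_zero hn
  set c : ℝ := 4 ^ (n + 1) / (n + 1).centralBinom
  set f : ℝ → ℝ := fun φ ↦ c * (Real.cos (φ / 2) * Real.sin (φ / 2) ^ (2 * n + 1))
  have hsin : ∀ φ ∈ Set.Ioo 0 θ, 0 < Real.sin (φ / 2) := fun φ hφ ↦
    Real.sin_pos_of_pos_of_lt_pi (by linarith [hφ.1]) (by linarith [hφ.1, hφ.2])
  have hcos : ∀ φ ∈ Set.Ioo 0 θ, 0 < Real.cos (φ / 2) := fun φ hφ ↦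
    Real.cos_pos_of_mem_Ioo ⟨by linarith [hφ.1], by linarith [hφ.1, hφ.2]⟩
  have h1 : ∫⁻ φ in Set.Ioo 0 θ, ENNReal.ofReal (Real.cot (φ / 2)) *
      ENNReal.ofReal (sinKernel (n + 1) φ) = ∫⁻ φ in Set.Ioo 0 θ, ENNReal.ofReal (f φ) := by
    refine setLIntegral_congr_fun measurableSet_Ioo fun φ hφ ↦ ?_
    have hs := hsin φ hφ
    have hc := hcos φ hφ
    rw [← ENNReal.ofReal_mul (by rw [Real.cot_eq_cos_div_sin]; positivity)]
    congr 1
    simp only [f, sinKernel, Real.cot_eq_cos_div_sin]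
    field_simp
    ring
  rw [Nat.succ_eq_add_one, h1, setLIntegral_Ioo_ofReal (by fun_prop) h0]
  · congr 1
    rw [intervalIntegral.integral_eq_sub_of_hasDerivAt (f := fun θ ↦
      sinKernel (n + 1) θ / (n + 1 : ℕ))]
    · simp [sinKernel]
    · intro x _
      have h2 : HasDerivAt (fun y : ℝ ↦ y / 2) (1 / 2) x := (hasDerivAt_id x).div_const 2
      have := ((h2.sin.pow (2 * (n + 1))).const_mul c).div_const ((n + 1 : ℕ) : ℝ)
      refine this.congr_deriv ?_
      rw [show 2 * (n + 1) - 1 = 2 * n + 1 by omega]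
      simp only [f]
      push_cast
      field_simp
    · exact (by fun_prop : Continuous f).intervalIntegrable _ _
  · intro φ hφ
    have hs := hsin φ hφ
    have hc := hcos φ hφ
    positivity

lemma sinGen_divCoeff {a : ℕ → ℝ≥0∞} (ha : a 0 = 0) {θ : ℝ} (h0 : 0 ≤ θ) (hpi : θ ≤ Real.pi) :
    sinGen (divCoeff a) θ =
      ∫⁻ φ in Set.Ioo 0 θ, ENNReal.ofReal (Real.cot (φ / 2)) * sinGen a φ := by
  have hm : Measurable fun φ : ℝ ↦ ENNReal.ofReal (Real.cot (φ / 2)) := by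
    have : Measurable fun φ : ℝ ↦ Real.cos (φ / 2) / Real.sin (φ / 2) := by fun_prop
    simpa only [Real.cot_eq_cos_div_sin] using this.ennreal_ofReal
  unfold sinGen
  simp_rw [← ENNReal.tsum_mul_left]
  have hm' (n : ℕ) : AEMeasurable (fun φ : ℝ ↦ ENNReal.ofReal (Real.cot (φ / 2)) *
      (a n * ENNReal.ofReal (sinKernel n φ))) (volume.restrict (Set.Ioo 0 θ)) :=
    (hm.mul ((measurable_ofReal_sinKernel n).const_mul _)).aemeasurable
  rw [lintegral_tsum hm']
  refine tsum_congr fun n ↦ ?_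
  simp_rw [mul_left_comm _ (a n)]
  have hm'' : Measurable (fun φ : ℝ ↦ ENNReal.ofReal (Real.cot (φ / 2)) *
      ENNReal.ofReal (sinKernel n φ)) := hm.mul (measurable_ofReal_sinKernel n)
  rw [lintegral_const_mul _ hm'']
  rcases eq_or_ne n 0 with rfl | hn
  · simp [divCoeff, ha]
  · rw [lintegral_cot_mul_sinKernel hn h0 hpi, ENNReal.ofReal_div_of_pos (by positivity),
      ENNReal.ofReal_natCast, ENNReal.div_eq_inv_mul, divCoeff]
    ring

/-- The iterated integral over `0 < θ₁ < ⋯ < θ_k < x` of `∏ τ_i(θ_i)`. -/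
noncomputable def iterInt (τ : ℕ → ℝ → ℝ≥0∞) : ℕ → ℝ → ℝ≥0∞
  | 0, _ => 1
  | k + 1, x => ∫⁻ y in Set.Ioo 0 x, τ (k + 1) y * iterInt τ k y

/-- The weights `cot (y / 2)` (for even `b`) and `tan (y / 2)` (for odd `b`). -/
noncomputable def altWeight (b : ℕ) (y : ℝ) : ℝ :=
  if Even b then Real.cot (y / 2) else Real.tan (y / 2)

/-- The weights `altWeight b` placed at the multiples `N * b` of `N`. -/
noncomputable def sparseWeight (N i : ℕ) (y : ℝ) : ℝ≥0∞ :=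
  if N ∣ i then ENNReal.ofReal (altWeight (i / N) y) else 1

lemma sparseWeight_mul {N : ℕ} (hN : 0 < N) (b : ℕ) (y : ℝ) :
    sparseWeight N (N * b) y = ENNReal.ofReal (altWeight b y) := by
  simp [sparseWeight, hN]

lemma sparseWeight_of_lt {N b i : ℕ} (h1 : N * b < i) (h2 : i < N * (b + 1)) (y : ℝ) :
    sparseWeight N i y = 1 := by
  refine if_neg ?_
  rintro ⟨c, rfl⟩
  have := Nat.lt_of_mul_lt_mul_left h1
  have := Nat.lt_of_mul_lt_mul_left h2
  omega

lemma sinGen_nextCoeff_two (a : ℕ → ℝ≥0∞) {y : ℝ} (h0 : 0 ≤ y) (hpi : y ≤ Real.pi) :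
    sinGen (nextCoeff 2 a) y =
      ∫⁻ z in Set.Ioo 0 y, ∫⁻ w in Set.Ioo 0 z, sinGen a w := by
  rw [nextCoeff_succ, sinGen_divCoeff (by simp [nextCoeff]) h0 hpi]
  refine setLIntegral_congr_fun measurableSet_Ioo fun z hz ↦ ?_
  have hs : 0 < Real.sin (z / 2) :=
    Real.sin_pos_of_pos_of_lt_pi (by linarith [hz.1]) (by linarith [hz.1, hz.2])
  have hc : 0 < Real.cos (z / 2) :=
    Real.cos_pos_of_mem_Ioo ⟨by linarith [hz.1], by linarith [hz.1, hz.2]⟩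
  rw [sinGen_nextCoeff_one a ⟨hz.1, hz.2.trans_le hpi⟩, ← mul_assoc,
    ← ENNReal.ofReal_mul (by rw [Real.cot_eq_cos_div_sin]; positivity)]
  rw [Real.cot_eq_cos_div_sin, Real.tan_eq_sin_div_cos]
  rw [show Real.cos (z / 2) / Real.sin (z / 2) * (Real.sin (z / 2) / Real.cos (z / 2)) = 1 by
    field_simp]
  simp

/-- The integrated binomial transform of `a` is the `i`-fold iterated integral. -/
def IsIter (τ : ℕ → ℝ → ℝ≥0∞) (a : ℕ → ℝ≥0∞) (i : ℕ) : Prop :=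
  ∀ x ≤ Real.pi, ∫⁻ φ in Set.Ioo 0 x, sinGen a φ = iterInt τ i x

lemma isIter_single {τ : ℕ → ℝ → ℝ≥0∞} (h : ∀ y, τ 1 y = 1) : IsIter τ (Pi.single 0 1) 1 := by
  intro x _
  simp only [iterInt, h]
  refine lintegral_congr fun y ↦ ?_
  rw [sinGen, tsum_eq_single 0 fun n hn ↦ by simp [hn]]
  simp [sinKernel]

lemma IsIter.nextCoeff_one {τ : ℕ → ℝ → ℝ≥0∞} {a : ℕ → ℝ≥0∞} {i : ℕ} (h : IsIter τ a i)
    (h1 : ∀ y, τ (i + 1) y = ENNReal.ofReal (Real.tan (y / 2))) :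
    IsIter τ (nextCoeff 1 a) (i + 1) := by
  intro x hx
  simp only [iterInt, h1]
  refine setLIntegral_congr_fun measurableSet_Ioo fun y hy ↦ ?_
  rw [sinGen_nextCoeff_one a ⟨hy.1, hy.2.trans_le hx⟩, h y (hy.2.le.trans hx)]

lemma IsIter.nextCoeff_two {τ : ℕ → ℝ → ℝ≥0∞} {a : ℕ → ℝ≥0∞} {i : ℕ} (h : IsIter τ a i)
    (h1 : ∀ y, τ (i + 1) y = 1) (h2 : ∀ y, τ (i + 2) y = 1) :
    IsIter τ (nextCoeff 2 a) (i + 2) := by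
  intro x hx
  simp only [iterInt, h1, h2, one_mul]
  refine setLIntegral_congr_fun measurableSet_Ioo fun y hy ↦ ?_
  rw [sinGen_nextCoeff_two a hy.1.le (hy.2.le.trans hx)]
  exact setLIntegral_congr_fun measurableSet_Ioo fun z hz ↦ h z (hz.2.le.trans (hy.2.le.trans hx))

lemma IsIter.nextCoeff_three {τ : ℕ → ℝ → ℝ≥0∞} {a : ℕ → ℝ≥0∞} {i : ℕ} (h : IsIter τ a i)
    (h1 : ∀ y, τ (i + 1) y = 1) (h2 : ∀ y, τ (i + 2) y = ENNReal.ofReal (Real.cot (y / 2)))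
    (h3 : ∀ y, τ (i + 3) y = 1) :
    IsIter τ (nextCoeff 3 a) (i + 3) := by
  intro x hx
  simp only [iterInt, h1, h2, h3, one_mul]
  refine setLIntegral_congr_fun measurableSet_Ioo fun y hy ↦ ?_
  have hy' := hy.2.le.trans hx
  rw [nextCoeff_succ, sinGen_divCoeff (by simp [nextCoeff]) hy.1.le hy']
  refine setLIntegral_congr_fun measurableSet_Ioo fun z hz ↦ ?_
  have hz' := hz.2.le.trans hy'
  rw [sinGen_nextCoeff_two a hz.1.le hz']
  congr 1
  exact setLIntegral_congr_fun measurableSet_Ioo fun w hw ↦ h w (hw.2.le.trans hz')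

lemma IsIter.foldl_replicate_two {τ : ℕ → ℝ → ℝ≥0∞} {a : ℕ → ℝ≥0∞} {i : ℕ} (h : IsIter τ a i)
    (m : ℕ) (hτ : ∀ j, i < j → j ≤ i + 2 * m → ∀ y, τ j y = 1) :
    IsIter τ ((List.replicate m 2).foldl (fun a s ↦ nextCoeff s a) a) (i + 2 * m) := by
  induction m with
  | zero => exact h
  | succ m ih =>
    rw [List.replicate_succ', List.foldl_append]
    exact (ih fun j h1 h2 ↦ hτ j h1 (by omega)).nextCoeff_two
      (hτ _ (by omega) (by omega)) (hτ _ (by omega) (by omega))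

lemma isIter_foldl (m n : ℕ) :
    IsIter (sparseWeight (2 * m + 2))
      ((List.replicate n (List.replicate m 2 ++ [1] ++ List.replicate m 2 ++ [3])).flatten.foldl
        (fun a s ↦ nextCoeff s a) (Pi.single 0 1)) ((2 * m + 2) * (2 * n) + 1) := by
  induction n with
  | zero => exact isIter_single (sparseWeight_of_lt (b := 0) (by omega) (by omega))
  | succ n ih =>
    set N := 2 * m + 2 with hN
    rw [List.replicate_succ', List.flatten_append]
    simp only [List.flatten_cons, List.flatten_nil, List.append_nil, List.foldl_append,
      List.foldl_cons, List.foldl_nil]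
    have e1 : N * (2 * n + 1) = N * (2 * n) + N := by ring
    have e2 : N * (2 * n + 1 + 1) = N * (2 * n) + 2 * N := by ring
    have e3 : N * (2 * n + 1 + 1 + 1) = N * (2 * n) + 3 * N := by ring
    have s1 := ih.foldl_replicate_two m fun j h1 h2 ↦
      sparseWeight_of_lt (b := 2 * n) (by omega) (by omega)
    have s2 := s1.nextCoeff_one fun y ↦ by
      rw [show N * (2 * n) + 1 + 2 * m + 1 = N * (2 * n + 1) by omega,
        sparseWeight_mul (by omega), altWeight, if_neg (by simp)]
    have s3 := s2.foldl_replicate_two m fun j h1 h2 ↦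
      sparseWeight_of_lt (b := 2 * n + 1) (by omega) (by omega)
    have s4 := s3.nextCoeff_three (sparseWeight_of_lt (b := 2 * n + 1) (by omega) (by omega))
      (fun y ↦ by
        rw [show N * (2 * n) + 1 + 2 * m + 1 + 2 * m + 2 = N * (2 * n + 1 + 1) by omega,
          sparseWeight_mul (by omega), altWeight, if_pos (by simp [Nat.even_add_one])])
      (sparseWeight_of_lt (b := 2 * n + 1 + 1) (by omega) (by omega))
    convert s4 using 1
    rw [show 2 * (n + 1) = 2 * n + 1 + 1 by ring]
    omega

lemma mzvTail_mul_pi (m n : ℕ) :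
    mzvTail ((List.replicate n
        (List.replicate m 2 ++ [1] ++ List.replicate m 2 ++ [3])).flatten ++ List.replicate m 2) 0 *
      ENNReal.ofReal Real.pi =
    iterInt (sparseWeight (2 * m + 2)) ((2 * m + 2) * (2 * n + 1) - 1) Real.pi := by
  rw [mzvTail_zero_eq, ← lintegral_sinGen_pi, List.foldl_append]
  have h := (isIter_foldl m n).foldl_replicate_two m fun j h1 h2 ↦
      sparseWeight_of_lt (b := 2 * n) (by omega)
        (by rw [show (2 * m + 2) * (2 * n + 1) = (2 * m + 2) * (2 * n) + (2 * m + 2) by ring]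
            omega)
  rw [h _ le_rfl]
  congr 1
  rw [show (2 * m + 2) * (2 * n + 1) = (2 * m + 2) * (2 * n) + (2 * m + 2) by ring]
  omega

lemma sum_prod_add_div_sub {ι F : Type*} [DecidableEq ι] [Field F] [CharZero F] {s : Finset ι}
    (hs : Odd #s) {z : ι → F} (hz : Set.InjOn z s) (h0 : ∀ i ∈ s, z i ≠ 0) :
    ∑ j ∈ s, ∏ i ∈ s.erase j, (z i + z j) / (z i - z j) = 1 := by
  set Q : Polynomial F := ∏ i ∈ s, (Polynomial.X - Polynomial.C (-z i)) -
    ∏ i ∈ s, (Polynomial.X - Polynomial.C (z i)) with hQ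
  have hdeg : Q.degree < #s := by
    have h1 := Polynomial.degree_prod_of_monic s (fun i ↦ Polynomial.X - Polynomial.C (-z i))
      fun i _ ↦ Polynomial.monic_X_sub_C _
    have h2 := Polynomial.degree_prod_of_monic s (fun i ↦ Polynomial.X - Polynomial.C (z i))
      fun i _ ↦ Polynomial.monic_X_sub_C _
    simp only [Polynomial.degree_X_sub_C, sum_const, nsmul_eq_mul, mul_one] at h1 h2
    have m1 := Polynomial.monic_prod_of_monic s (fun i ↦ Polynomial.X - Polynomial.C (-z i))
      fun i _ ↦ Polynomial.monic_X_sub_C _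
    have m2 := Polynomial.monic_prod_of_monic s (fun i ↦ Polynomial.X - Polynomial.C (z i))
      fun i _ ↦ Polynomial.monic_X_sub_C _
    have := Polynomial.degree_sub_lt_left (h1.trans h2.symm) m1.ne_zero
      (m1.leadingCoeff.trans m2.leadingCoeff.symm)
    rwa [h1] at this
  have h := congrArg (Polynomial.eval 0) (Lagrange.eq_interpolate hz hdeg)
  have hprod : ∏ i ∈ s, z i ≠ 0 := prod_ne_zero_iff.2 h0
  have hl : Q.eval 0 = 2 * ∏ i ∈ s, z i := by
    simp only [hQ, Polynomial.eval_sub, Polynomial.eval_prod, Polynomial.eval_X,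
      Polynomial.eval_C, zero_sub, neg_neg, prod_neg, hs.neg_one_pow]
    ring
  rw [hl, Lagrange.interpolate_apply, Polynomial.eval_finsetSum] at h
  have hr : ∀ j ∈ s, (Polynomial.C (Q.eval (z j)) * Lagrange.basis s z j).eval 0 =
      2 * (∏ i ∈ s, z i) * ∏ i ∈ s.erase j, (z i + z j) / (z i - z j) := by
    intro j hj
    have e1 : Q.eval (z j) = 2 * z j * ∏ i ∈ s.erase j, (z i + z j) := by
      simp only [hQ, Polynomial.eval_sub, Polynomial.eval_prod, Polynomial.eval_X,
        Polynomial.eval_C, sub_neg_eq_add]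
      rw [prod_eq_zero (f := fun i ↦ z j - z i) hj (sub_self (z j)), sub_zero,
        ← mul_prod_erase s _ hj, two_mul]
      simp_rw [add_comm (z j)]
    have e2 : (Lagrange.basis s z j).eval 0 = ∏ i ∈ s.erase j, z i / (z i - z j) := by
      rw [Lagrange.basis, Polynomial.eval_prod]
      refine prod_congr rfl fun i hi ↦ ?_
      rw [Lagrange.basisDivisor]
      simp only [Polynomial.eval_mul, Polynomial.eval_C, Polynomial.eval_sub, Polynomial.eval_X]
      rw [← neg_sub (z i) (z j), inv_neg, zero_sub, neg_mul_neg, div_eq_inv_mul]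
    rw [Polynomial.eval_mul, Polynomial.eval_C, e1, e2, ← mul_prod_erase s z hj, prod_div_distrib,
      prod_div_distrib]
    ring
  rw [sum_congr rfl hr, ← mul_sum] at h
  exact (mul_right_eq_self₀.1 h.symm).resolve_right (by simpa using hprod)

lemma prod_range_shift {M : Type*} [CommMonoid M] {f : ℕ → M} {n j : ℕ}
    (hf : ∀ i, f (i + (n + 1)) = f i) (hj : j < n + 1) :
    ∏ b ∈ range n, f (b + 1 + j) = ∏ i ∈ (range (n + 1)).erase j, f i := by
  refine prod_nbij' (fun b ↦ if b + 1 + j < n + 1 then b + 1 + j else b + 1 + j - (n + 1))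
    (fun i ↦ if j < i then i - j - 1 else i + (n + 1) - j - 1) ?_ ?_ ?_ ?_ ?_
  · intro b hb
    simp only [mem_range, mem_erase] at hb ⊢
    split_ifs <;> omega
  · intro i hi
    simp only [mem_range, mem_erase] at hi ⊢
    split_ifs <;> omega
  · intro b hb
    simp only [mem_range] at hb ⊢
    split_ifs <;> omega
  · intro i hi
    simp only [mem_range, mem_erase] at hi ⊢
    split_ifs <;> omega
  · intro b hb
    split_ifs with h
    · rfl
    · rw [← hf (b + 1 + j - (n + 1))]
      congr 1
      omega

lemma exp_mul_I_sub_exp_mul_I (x y : ℝ) :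
    Complex.exp (y * Complex.I) - Complex.exp (x * Complex.I) =
      2 * Complex.I * Real.sin ((y - x) / 2) * Complex.exp (((x + y) / 2 : ℝ) * Complex.I) := by
  have h1 : Complex.exp (y * Complex.I) = Complex.exp (((x + y) / 2 : ℝ) * Complex.I) *
      Complex.exp (((y - x) / 2 : ℝ) * Complex.I) := by
    rw [← Complex.exp_add]; congr 1; push_cast; ring
  have h2 : Complex.exp (x * Complex.I) = Complex.exp (((x + y) / 2 : ℝ) * Complex.I) *
      Complex.exp (-((y - x) / 2 : ℝ) * Complex.I) := by
    rw [← Complex.exp_add]; congr 1; push_cast; ring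
  rw [h1, h2, Complex.exp_mul_I ((y - x) / 2 : ℝ), Complex.exp_mul_I (-((y - x) / 2 : ℝ)),
    Complex.cos_neg, Complex.sin_neg,
    Complex.ofReal_sin]
  ring

lemma exp_mul_I_add_exp_mul_I (x y : ℝ) :
    Complex.exp (y * Complex.I) + Complex.exp (x * Complex.I) =
      2 * Real.cos ((y - x) / 2) * Complex.exp (((x + y) / 2 : ℝ) * Complex.I) := by
  have h1 : Complex.exp (y * Complex.I) = Complex.exp (((x + y) / 2 : ℝ) * Complex.I) *
      Complex.exp (((y - x) / 2 : ℝ) * Complex.I) := by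
    rw [← Complex.exp_add]; congr 1; push_cast; ring
  have h2 : Complex.exp (x * Complex.I) = Complex.exp (((x + y) / 2 : ℝ) * Complex.I) *
      Complex.exp (-((y - x) / 2 : ℝ) * Complex.I) := by
    rw [← Complex.exp_add]; congr 1; push_cast; ring
  rw [h1, h2, Complex.exp_mul_I ((y - x) / 2 : ℝ), Complex.exp_mul_I (-((y - x) / 2 : ℝ)),
    Complex.cos_neg, Complex.sin_neg,
    Complex.ofReal_cos]
  ring

/-- The points `(-1) ^ i * exp (I * u i)` on the unit circle. -/
noncomputable def altExp (u : ℕ → ℝ) (i : ℕ) : ℂ := (-1) ^ i * Complex.exp (u i * Complex.I)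

lemma altExp_ne_zero (u : ℕ → ℝ) (i : ℕ) : altExp u i ≠ 0 := by simp [altExp]

lemma altWeight_eq (u : ℕ → ℝ) (b j : ℕ) :
    (altWeight b (u (b + j) - u j) : ℂ) = (-1) ^ b * Complex.I *
      ((altExp u (b + j) + altExp u j) / (altExp u (b + j) - altExp u j)) := by
  have hj : ((-1) ^ j : ℂ) ≠ 0 := by simp
  set E := Complex.exp (((u j + u (b + j)) / 2 : ℝ) * Complex.I) with hE
  have hE0 : E ≠ 0 := Complex.exp_ne_zero _
  have h1 := exp_mul_I_sub_exp_mul_I (u j) (u (b + j))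
  have h2 := exp_mul_I_add_exp_mul_I (u j) (u (b + j))
  rw [← hE] at h1 h2
  simp only [altExp, pow_add, altWeight, mul_comm ((-1 : ℂ) ^ b)]
  set B := Complex.exp (u j * Complex.I)
  set A := Complex.exp (u (b + j) * Complex.I)
  set s := Real.sin ((u (b + j) - u j) / 2) with hs
  set c := Real.cos ((u (b + j) - u j) / 2) with hc
  have hI := Complex.I_mul_I
  split_ifs with hb
  · rw [hb.neg_one_pow, mul_one, mul_one, ← mul_add, ← mul_sub, mul_div_mul_left _ _ hj, h1, h2,
      mul_div_mul_right _ _ hE0, Real.cot_eq_cos_div_sin, mul_assoc,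
      mul_div_mul_left _ _ two_ne_zero, ← mul_div_assoc, mul_div_mul_left _ _ Complex.I_ne_zero]
    exact Complex.ofReal_div c s
  · rw [(Nat.not_even_iff_odd.1 hb).neg_one_pow, mul_assoc, mul_assoc, ← mul_add, ← mul_sub,
      mul_div_mul_left _ _ hj, show -1 * A + B = -(A - B) by ring,
      show -1 * A - B = -(A + B) by ring, h1, h2, neg_div_neg_eq, mul_div_mul_right _ _ hE0,
      mul_assoc, mul_div_mul_left _ _ two_ne_zero,
      Real.tan_eq_sin_div_cos, mul_div_assoc, Complex.ofReal_div]
    linear_combination ((s : ℂ) / c) * hI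

lemma altExp_injOn {u : ℕ → ℝ} {k : ℕ} (hu : StrictMono u) (hk : ∀ i, u (i + k) = u i + Real.pi) :
    Set.InjOn (altExp u) (range k) := by
  have key : ∀ i j, i < j → j < k → altExp u i ≠ altExp u j := by
    intro i j hij hjk h
    have h0 : 0 < u j - u i := sub_pos.2 (hu hij)
    have h1 : u j - u i < Real.pi := by
      have := hu (show j < i + k by omega)
      rw [hk] at this
      linarith
    have hs : Real.sin ((u j - u i) / 2) ≠ 0 :=
      (Real.sin_pos_of_pos_of_lt_pi (by linarith) (by linarith)).ne'
    have hc : Real.cos ((u j - u i) / 2) ≠ 0 :=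
      (Real.cos_pos_of_mem_Ioo ⟨by linarith, by linarith⟩).ne'
    have hd := exp_mul_I_sub_exp_mul_I (u i) (u j)
    have ha := exp_mul_I_add_exp_mul_I (u i) (u j)
    have hd0 : Complex.exp (u j * Complex.I) - Complex.exp (u i * Complex.I) ≠ 0 := by
      rw [hd]
      simp only [ne_eq, mul_eq_zero, Complex.I_ne_zero, Complex.exp_ne_zero, Complex.ofReal_eq_zero,
        hs, two_ne_zero, or_self, not_false_eq_true]
    have ha0 : Complex.exp (u j * Complex.I) + Complex.exp (u i * Complex.I) ≠ 0 := by
      rw [ha]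
      simp only [ne_eq, mul_eq_zero, Complex.exp_ne_zero, Complex.ofReal_eq_zero,
        hc, two_ne_zero, or_self, not_false_eq_true]
    simp only [altExp] at h
    rcases neg_one_pow_eq_or ℂ i with hi | hi <;> rcases neg_one_pow_eq_or ℂ j with hj | hj <;>
      rw [hi, hj] at h
    · exact hd0 (by linear_combination -h)
    · exact ha0 (by linear_combination h)
    · exact ha0 (by linear_combination -h)
    · exact hd0 (by linear_combination h)
  intro i hi j hj h
  simp only [coe_range, Set.mem_Iio] at hi hj
  rcases lt_trichotomy i j with hij | hij | hij
  · exact absurd h (key i j hij hj)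
  · exact hij
  · exact absurd h.symm (key j i hij hi)

lemma sum_prod_altWeight {u : ℕ → ℝ} {n : ℕ} (hu : StrictMono u)
    (hk : ∀ i, u (i + (2 * n + 1)) = u i + Real.pi) :
    ∑ j ∈ range (2 * n + 1), ∏ b ∈ range (2 * n), altWeight (b + 1) (u (b + 1 + j) - u j) = 1 := by
  have hper : ∀ i, altExp u (i + (2 * n + 1)) = altExp u i := by
    intro i
    simp only [altExp, hk]
    rw [pow_add, Odd.neg_one_pow ⟨n, rfl⟩]
    push_cast
    rw [add_mul, Complex.exp_add, Complex.exp_pi_mul_I]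
    ring
  have hsign : ∀ n : ℕ, ∏ b ∈ range (2 * n), ((-1) ^ (b + 1) * Complex.I) = 1 := by
    intro n
    induction n with
    | zero => simp
    | succ n ih =>
      rw [show 2 * (n + 1) = 2 * n + 1 + 1 by ring, prod_range_succ, prod_range_succ, ih]
      have : ((-1) ^ (2 * n) : ℂ) = 1 := (even_two_mul n).neg_one_pow
      simp only [pow_succ, this]
      linear_combination -Complex.I_mul_I
  have h := sum_prod_add_div_sub (s := range (2 * n + 1)) (by simp) (altExp_injOn hu hk)
    fun i _ ↦ altExp_ne_zero u i
  rw [← Complex.ofReal_inj, Complex.ofReal_one, ← h]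
  push_cast
  refine sum_congr rfl fun j hj ↦ ?_
  simp_rw [altWeight_eq]
  rw [prod_mul_distrib, hsign, one_mul]
  exact prod_range_shift (f := fun i ↦ (altExp u i + altExp u j) / (altExp u i - altExp u j))
    (fun i ↦ by rw [hper]) (by simpa using hj)

/-- The open simplex `0 < θ₀ < ⋯ < θ_{d-1} < x`. -/
def openSimplex (d : ℕ) (x : ℝ) : Set (Fin d → ℝ) :=
  {θ | StrictMono θ ∧ ∀ i, θ i ∈ Set.Ioo 0 x}

lemma measurableSet_openSimplex (d : ℕ) (x : ℝ) : MeasurableSet (openSimplex d x) := by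
  have : openSimplex d x = (⋂ i, ⋂ j, {θ | i < j → θ i < θ j}) ∩ ⋂ i, {θ | θ i ∈ Set.Ioo 0 x} := by
    ext θ
    simp [openSimplex, StrictMono]
  rw [this]
  refine .inter (.iInter fun i ↦ .iInter fun j ↦ ?_) (.iInter fun i ↦ ?_)
  · by_cases h : i < j
    · simpa [h] using measurableSet_lt (measurable_pi_apply i) (measurable_pi_apply j)
    · simp [h]
  · exact measurable_pi_apply i measurableSet_Ioo

lemma snoc_mem_openSimplex {d : ℕ} {x y : ℝ} {θ : Fin d → ℝ} :
    (Fin.snoc θ y : Fin (d + 1) → ℝ) ∈ openSimplex (d + 1) x ↔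
      y ∈ Set.Ioo 0 x ∧ θ ∈ openSimplex d y := by
  simp only [openSimplex, Set.mem_ofPred_eq, StrictMono, Fin.forall_fin_succ', Fin.snoc_castSucc,
    Fin.snoc_last, Fin.castSucc_lt_castSucc_iff, Fin.castSucc_lt_last, forall_const, lt_irrefl,
    false_imp_iff, and_true]
  have hlast (i : Fin d) : ¬ Fin.last d < i.castSucc := (Fin.castSucc_lt_last i).not_gt
  simp only [hlast, false_imp_iff, implies_true, and_true]
  constructor
  · rintro ⟨h1, h2, h3⟩
    exact ⟨h3, fun a b ↦ (h1 a).1 b, fun i ↦ ⟨(h2 i).1, (h1 i).2⟩⟩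
  · rintro ⟨h1, h2, h3⟩
    exact ⟨fun a ↦ ⟨fun b hab ↦ h2 hab, (h3 a).2⟩, fun i ↦ ⟨(h3 i).1, (h3 i).2.trans h1.2⟩, h1⟩

lemma measurable_prod_apply {τ : ℕ → ℝ → ℝ≥0∞} (hτ : ∀ i, Measurable (τ i)) (d : ℕ) :
    Measurable fun θ : Fin d → ℝ ↦ ∏ i : Fin d, τ (i + 1) (θ i) :=
  Finset.measurable_prod _ fun i _ ↦ (hτ _).comp (measurable_pi_apply i)

lemma iterInt_eq_lintegral {τ : ℕ → ℝ → ℝ≥0∞} (hτ : ∀ i, Measurable (τ i)) (d : ℕ) (x : ℝ) :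
    iterInt τ d x = ∫⁻ θ in openSimplex d x, ∏ i : Fin d, τ (i + 1) (θ i) := by
  induction d generalizing x with
  | zero =>
    have : openSimplex 0 x = Set.univ := by
      ext θ; simp [openSimplex, StrictMono]
    simp [iterInt, this, Measure.volume_pi_eq_dirac (default : Fin 0 → ℝ)]
  | succ d ih =>
    have hm : Measurable fun θ : Fin (d + 1) → ℝ ↦ (openSimplex (d + 1) x).indicator
        (fun θ ↦ ∏ i : Fin (d + 1), τ (i + 1) (θ i)) θ :=
      (measurable_prod_apply hτ _).indicator (measurableSet_openSimplex _ _)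
    have e := (volume_preserving_piFinSuccAbove (fun _ : Fin (d + 1) ↦ ℝ) (Fin.last d)).symm
    rw [← lintegral_indicator (measurableSet_openSimplex _ _), ← e.lintegral_comp hm,
      Measure.volume_eq_prod, iterInt, ← lintegral_indicator measurableSet_Ioo]
    refine Eq.trans ?_ (lintegral_prod _ (hm.comp e.measurable).aemeasurable).symm
    refine lintegral_congr fun y ↦ ?_
    have hs (θ : Fin d → ℝ) :
        (MeasurableEquiv.piFinSuccAbove (fun _ : Fin (d + 1) ↦ ℝ) (Fin.last d)).symm (y, θ) =
          (Fin.snoc θ y : Fin (d + 1) → ℝ) := by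
      simp [MeasurableEquiv.piFinSuccAbove, Fin.insertNthEquiv]
    simp only [Function.comp_apply, hs]
    by_cases hy : y ∈ Set.Ioo 0 x
    · rw [Set.indicator_of_mem hy, ih, ← lintegral_const_mul _ (measurable_prod_apply hτ d),
        ← lintegral_indicator (measurableSet_openSimplex _ _)]
      refine lintegral_congr fun θ ↦ ?_
      by_cases hθ : θ ∈ openSimplex d y
      · rw [Set.indicator_of_mem hθ, Set.indicator_of_mem (snoc_mem_openSimplex.2 ⟨hy, hθ⟩),
          Fin.prod_univ_castSucc]
        simp [mul_comm]
      · rw [Set.indicator_of_notMem hθ,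
          Set.indicator_of_notMem fun h ↦ hθ (snoc_mem_openSimplex.1 h).2]
    · rw [Set.indicator_of_notMem hy]
      simp [Set.indicator_of_notMem fun h ↦ hy (snoc_mem_openSimplex.1 h).1]

lemma volume_openSimplex (d : ℕ) {x : ℝ} (hx : 0 ≤ x) :
    volume (openSimplex d x) = ENNReal.ofReal (x ^ d / d.factorial) := by
  have h : ∀ d, ∀ x : ℝ, 0 ≤ x →
      iterInt (fun _ _ ↦ 1) d x = ENNReal.ofReal (x ^ d / d.factorial) := by
    intro d
    induction d with
    | zero => simp [iterInt]
    | succ d ih =>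
      intro x hx
      rw [iterInt]
      calc _ = ∫⁻ y in Set.Ioo 0 x, ENNReal.ofReal (y ^ d / d.factorial) :=
            setLIntegral_congr_fun measurableSet_Ioo fun y hy ↦ by simp [ih y hy.1.le]
        _ = _ := by
            rw [setLIntegral_Ioo_ofReal (by fun_prop) hx fun y hy ↦ by
              have := hy.1; positivity]
            congr 1
            rw [intervalIntegral.integral_div, integral_pow, Nat.factorial_succ]
            push_cast
            field_simp
            simp
  rw [← h d x hx, iterInt_eq_lintegral fun _ ↦ measurable_const]
  simp

/-- The cyclic shift of the simplex `0 < θ₀ < ⋯ < θ_d < c`. -/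
def cyclicShift (c : ℝ) {d : ℕ} (θ : Fin (d + 1) → ℝ) : Fin (d + 1) → ℝ :=
  Fin.snoc (fun i : Fin d ↦ θ i.succ - θ 0) (c - θ 0)

lemma measurePreserving_cyclicShift (c : ℝ) (d : ℕ) :
    MeasurePreserving (cyclicShift c : (Fin (d + 1) → ℝ) → Fin (d + 1) → ℝ) := by
  have e0 := volume_preserving_piFinSuccAbove (fun _ : Fin (d + 1) ↦ ℝ) 0
  have e1 := (volume_preserving_piFinSuccAbove (fun _ : Fin (d + 1) ↦ ℝ) (Fin.last d)).symm
  have hg : Measurable (Function.uncurry fun (a : ℝ) (b : Fin d → ℝ) (i : Fin d) ↦ b i - a) := by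
    refine measurable_pi_lambda _ fun i ↦ ?_
    exact ((measurable_pi_apply i).comp measurable_snd).sub measurable_fst
  have h := (Measure.measurePreserving_sub_left (volume : Measure ℝ) c).skew_product hg
    (μc := volume) (μd := volume)
    (Filter.Eventually.of_forall fun a ↦
      (measurePreserving_sub_right (volume : Measure (Fin d → ℝ)) fun _ ↦ a).map_eq)
  have := e1.comp (h.comp e0)
  convert this using 1
  funext θ
  simp only [Function.comp_apply, MeasurableEquiv.piFinSuccAbove, Fin.insertNthEquiv, cyclicShift]
  simp
  rfl

/-- The extension of `0 < θ₀ < ⋯ < θ_d < c` to a `c`-quasiperiodic sequence starting at `0`. -/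
def quasiExt (c : ℝ) {d : ℕ} (θ : Fin (d + 1) → ℝ) (i : ℕ) : ℝ :=
  (i / (d + 2) : ℕ) * c + (Fin.cons 0 θ : Fin (d + 2) → ℝ) (Fin.ofNat (d + 2) i)

section quasiExt

variable (c : ℝ) {d : ℕ} (θ : Fin (d + 1) → ℝ)

lemma quasiExt_add (i : ℕ) : quasiExt c θ (i + (d + 2)) = quasiExt c θ i + c := by
  simp only [quasiExt, Fin.ofNat, Nat.add_mod_right]
  rw [Nat.add_div_right _ (by omega)]
  push_cast
  ring

lemma quasiExt_zero : quasiExt c θ 0 = 0 := by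
  simp [quasiExt]

lemma quasiExt_succ (i : Fin (d + 1)) : quasiExt c θ (i + 1) = θ i := by
  have hi : (i : ℕ) + 1 < d + 2 := by omega
  have : Fin.ofNat (d + 2) (i + 1) = i.succ := by
    ext; simp [Nat.mod_eq_of_lt hi]
  rw [quasiExt, Nat.div_eq_of_lt hi, this]
  simp

lemma quasiExt_last : quasiExt c θ (d + 2) = c := by
  rw [← zero_add (d + 2), quasiExt_add, quasiExt_zero, zero_add]

lemma quasiExt_cyclicShift (i : ℕ) :
    quasiExt c (cyclicShift c θ) i = quasiExt c θ (i + 1) - quasiExt c θ 1 := by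
  have h1 : quasiExt c θ 1 = θ 0 := quasiExt_succ c θ 0
  induction i using Nat.strong_induction_on with
  | _ i ih =>
    rcases lt_or_ge i (d + 2) with hi | hi
    · rcases i with _ | i
      · simp [quasiExt_zero]
      · rw [h1]
        refine (quasiExt_succ c (cyclicShift c θ) ⟨i, by omega⟩).trans ?_
        rcases Nat.lt_or_ge i d with hd | hd
        · have e1 := quasiExt_succ c θ ⟨i + 1, by omega⟩
          have e2 : (⟨i, by omega⟩ : Fin (d + 1)) = Fin.castSucc ⟨i, hd⟩ := rfl
          simp only at e1
          rw [e1, e2, cyclicShift, Fin.snoc_castSucc]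
          rfl
        · obtain rfl : i = d := by omega
          have e2 : (⟨i, by omega⟩ : Fin (i + 1)) = Fin.last i := rfl
          rw [quasiExt_last, e2, cyclicShift, Fin.snoc_last]
    · obtain ⟨i, rfl⟩ := Nat.exists_eq_add_of_le' hi
      rw [quasiExt_add, ih i (by omega), add_right_comm, quasiExt_add]
      ring

lemma quasiExt_cyclicShift_iterate (j i : ℕ) :
    quasiExt c ((cyclicShift c)^[j] θ) i = quasiExt c θ (i + j) - quasiExt c θ j := by
  induction j generalizing i with
  | zero => simp [quasiExt_zero]
  | succ j ih =>
    rw [Function.iterate_succ_apply', quasiExt_cyclicShift, ih, ih]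
    rw [show i + 1 + j = i + (j + 1) by ring, show 1 + j = j + 1 by ring]
    ring

lemma mem_openSimplex_iff_strictMono_quasiExt :
    θ ∈ openSimplex (d + 1) c ↔ StrictMono (quasiExt c θ) := by
  constructor
  · rintro ⟨h1, h2⟩
    refine strictMono_nat_of_lt_succ fun i ↦ ?_
    induction i using Nat.strong_induction_on with
    | _ i ih =>
      rcases lt_or_ge i (d + 2) with hi | hi
      · rcases i with _ | i
        · rw [quasiExt_zero]
          exact (quasiExt_succ c θ 0).symm ▸ (h2 0).1
        · have e0 := quasiExt_succ c θ ⟨i, by omega⟩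
          simp only at e0
          rw [e0]
          rcases Nat.lt_or_ge i d with hd | hd
          · have e1 := quasiExt_succ c θ ⟨i + 1, by omega⟩
            simp only at e1
            rw [e1]
            exact h1 (by simp)
          · obtain rfl : i = d := by omega
            rw [quasiExt_last]
            exact (h2 _).2
      · obtain ⟨i, rfl⟩ := Nat.exists_eq_add_of_le' hi
        rw [quasiExt_add, add_right_comm, quasiExt_add]
        linarith [ih i (by omega)]
  · intro h
    refine ⟨fun i j hij ↦ ?_, fun i ↦ ⟨?_, ?_⟩⟩
    · rw [← quasiExt_succ c θ i, ← quasiExt_succ c θ j]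
      exact h (by simpa using hij)
    · rw [← quasiExt_succ c θ i, ← quasiExt_zero c θ]
      exact h (by simp)
    · rw [← quasiExt_succ c θ i]
      exact (h (by omega : (i : ℕ) + 1 < d + 2)).trans_eq (quasiExt_last c θ)

lemma cyclicShift_preimage_openSimplex :
    (cyclicShift c : (Fin (d + 1) → ℝ) → _) ⁻¹' openSimplex (d + 1) c = openSimplex (d + 1) c := by
  ext θ
  rw [Set.mem_preimage, mem_openSimplex_iff_strictMono_quasiExt,
    mem_openSimplex_iff_strictMono_quasiExt]
  constructor
  · intro h i j hij
    have := h (show i + (d + 1) < j + (d + 1) by omega)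
    rw [quasiExt_cyclicShift, quasiExt_cyclicShift, add_assoc i, add_assoc j,
      quasiExt_add, quasiExt_add] at this
    linarith
  · intro h i j hij
    rw [quasiExt_cyclicShift, quasiExt_cyclicShift]
    exact sub_lt_sub_right (h (by omega)) _

lemma lintegral_openSimplex_cyclicShift_iterate (j : ℕ) {f : (Fin (d + 1) → ℝ) → ℝ≥0∞}
    (hf : Measurable f) :
    ∫⁻ θ in openSimplex (d + 1) c, f ((cyclicShift c)^[j] θ) =
      ∫⁻ θ in openSimplex (d + 1) c, f θ := by
  have hpre : (cyclicShift c : (Fin (d + 1) → ℝ) → _)^[j] ⁻¹' openSimplex (d + 1) c =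
      openSimplex (d + 1) c := by
    rw [Set.preimage_iterate_eq]
    exact Function.iterate_fixed (cyclicShift_preimage_openSimplex c) j
  have := ((measurePreserving_cyclicShift c d).iterate j).setLIntegral_comp_preimage
    (measurableSet_openSimplex (d + 1) c) hf
  rwa [hpre] at this

end quasiExt

lemma measurable_sparseWeight (N i : ℕ) : Measurable (sparseWeight N i) := by
  have hc : Measurable fun y : ℝ ↦ Real.cos (y / 2) / Real.sin (y / 2) := by fun_prop
  have ht : Measurable fun y : ℝ ↦ Real.sin (y / 2) / Real.cos (y / 2) := by fun_prop
  simp only [← Real.cot_eq_cos_div_sin, ← Real.tan_eq_sin_div_cos] at hc ht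
  unfold sparseWeight altWeight
  split_ifs
  · exact hc.ennreal_ofReal
  · exact ht.ennreal_ofReal
  · exact measurable_const

lemma prod_sparseWeight {N d r : ℕ} (hN : 0 < N) (hd : N * (r + 1) = d + 2) (v : ℕ → ℝ) :
    ∏ i ∈ range (d + 1), sparseWeight N (i + 1) (v (i + 1)) =
      ∏ b ∈ range r, ENNReal.ofReal (altWeight (b + 1) (v (N * (b + 1)))) := by
  have hpos (b : ℕ) : N * (b + 1) - 1 + 1 = N * (b + 1) :=
    Nat.sub_add_cancel (Nat.mul_pos hN b.succ_pos)
  have himg : ∏ b ∈ range r, ENNReal.ofReal (altWeight (b + 1) (v (N * (b + 1)))) =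
      ∏ i ∈ (range r).image (fun b ↦ N * (b + 1) - 1), sparseWeight N (i + 1) (v (i + 1)) := by
    rw [prod_image]
    · exact prod_congr rfl fun b _ ↦ by rw [hpos, sparseWeight_mul hN]
    · intro a _ b _ hab
      have : N * (a + 1) = N * (b + 1) := by rw [← hpos a, ← hpos b]; simp only at hab; rw [hab]
      have := Nat.eq_of_mul_eq_mul_left hN this
      omega
  rw [himg]
  symm
  refine prod_subset ?_ fun i hi hi' ↦ ?_
  · intro i hi
    obtain ⟨b, hb, rfl⟩ := mem_image.1 hi
    have := Nat.mul_lt_mul_of_pos_left (show b + 1 < r + 1 by simpa using hb) hN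
    have := hpos b
    simp only [mem_range]
    omega
  · refine if_neg ?_
    rintro ⟨b, hb⟩
    refine hi' (mem_image.2 ⟨b - 1, ?_, ?_⟩)
    · have h1 : N * b < N * (r + 1) := by
        have := mem_range.1 hi
        omega
      have h2 := Nat.lt_of_mul_lt_mul_left h1
      have h3 : b ≠ 0 := by rintro rfl; simp at hb
      simp only [mem_range]
      omega
    · have h3 : b ≠ 0 := by rintro rfl; simp at hb
      rw [Nat.sub_add_cancel (Nat.one_le_iff_ne_zero.2 h3), ← hb, Nat.add_sub_cancel]

lemma altWeight_nonneg (b : ℕ) {y : ℝ} (h0 : 0 ≤ y) (hpi : y ≤ Real.pi) : 0 ≤ altWeight b y := by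
  have hs : 0 ≤ Real.sin (y / 2) :=
    Real.sin_nonneg_of_nonneg_of_le_pi (by linarith) (by linarith)
  have hc : 0 ≤ Real.cos (y / 2) :=
    Real.cos_nonneg_of_mem_Icc ⟨by linarith, by linarith⟩
  unfold altWeight
  split_ifs
  · rw [Real.cot_eq_cos_div_sin]; positivity
  · rw [Real.tan_eq_sin_div_cos]; positivity

lemma sum_prod_sparseWeight {N d n : ℕ} (hN : 0 < N) (hd : N * (2 * n + 1) = d + 2)
    {θ : Fin (d + 1) → ℝ} (hθ : θ ∈ openSimplex (d + 1) Real.pi) :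
    ∑ j ∈ range (2 * n + 1), ∏ i : Fin (d + 1),
      sparseWeight N (i + 1) ((cyclicShift Real.pi)^[N * j] θ i) = 1 := by
  have hmono := (mem_openSimplex_iff_strictMono_quasiExt _ _).1 hθ
  set u : ℕ → ℝ := fun b ↦ quasiExt Real.pi θ (N * b) with hu
  have humono : StrictMono u := fun a b hab ↦ hmono (Nat.mul_lt_mul_of_pos_left hab hN)
  have huk : ∀ i, u (i + (2 * n + 1)) = u i + Real.pi := fun i ↦ by
    simp only [hu, mul_add N i, hd, quasiExt_add]
  have hterm : ∀ j, ∏ i : Fin (d + 1), sparseWeight N (i + 1) ((cyclicShift Real.pi)^[N * j] θ i) =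
      ENNReal.ofReal (∏ b ∈ range (2 * n), altWeight (b + 1) (u (b + 1 + j) - u j)) := by
    intro j
    rw [ENNReal.ofReal_prod_of_nonneg]
    · have := prod_sparseWeight hN hd (quasiExt Real.pi ((cyclicShift Real.pi)^[N * j] θ))
      simp only [prod_range, quasiExt_succ] at this ⊢
      rw [this]
      refine prod_congr rfl fun b _ ↦ ?_
      rw [quasiExt_cyclicShift_iterate, ← mul_add]
    · intro b hb
      refine altWeight_nonneg _ (sub_nonneg.2 (humono.monotone (by omega))) ?_
      rw [sub_le_iff_le_add', ← huk]
      have := mem_range.1 hb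
      exact humono.monotone (by omega)
  simp_rw [hterm]
  rw [← ENNReal.ofReal_sum_of_nonneg, sum_prod_altWeight humono huk, ENNReal.ofReal_one]
  intro j _
  refine prod_nonneg fun b hb ↦ ?_
  refine altWeight_nonneg _ (sub_nonneg.2 (humono.monotone (by omega))) ?_
  rw [sub_le_iff_le_add', ← huk]
  have := mem_range.1 hb
  exact humono.monotone (by omega)

lemma iterInt_sparseWeight {N d n : ℕ} (hN : 0 < N) (hd : N * (2 * n + 1) = d + 2) :
    (2 * n + 1 : ℕ) * iterInt (sparseWeight N) (d + 1) Real.pi =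
      ENNReal.ofReal (Real.pi ^ (d + 1) / (d + 1).factorial) := by
  have hm := measurable_prod_apply (measurable_sparseWeight N) (d + 1)
  calc (2 * n + 1 : ℕ) * iterInt (sparseWeight N) (d + 1) Real.pi
      = ∑ j ∈ range (2 * n + 1), ∫⁻ θ in openSimplex (d + 1) Real.pi,
          ∏ i : Fin (d + 1), sparseWeight N (i + 1) ((cyclicShift Real.pi)^[N * j] θ i) := by
        rw [sum_congr rfl fun j _ ↦
          lintegral_openSimplex_cyclicShift_iterate Real.pi (N * j) hm, sum_const, card_range,
          nsmul_eq_mul, iterInt_eq_lintegral (measurable_sparseWeight N)]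
    _ = ∫⁻ θ in openSimplex (d + 1) Real.pi, ∑ j ∈ range (2 * n + 1),
          ∏ i : Fin (d + 1), sparseWeight N (i + 1) ((cyclicShift Real.pi)^[N * j] θ i) :=
        (lintegral_finsetSum _ fun j _ ↦
          hm.comp ((measurePreserving_cyclicShift Real.pi d).iterate (N * j)).measurable).symm
    _ = ∫⁻ _ in openSimplex (d + 1) Real.pi, 1 :=
        setLIntegral_congr_fun (measurableSet_openSimplex _ _) fun _ hθ ↦
          sum_prod_sparseWeight hN hd hθ
    _ = _ := by rw [setLIntegral_one, volume_openSimplex _ Real.pi_pos.le]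

/-- `ζ({ {2}^m, 1, {2}^m, 3 }^n, {2}^m)` is a rational multiple of `π ^ (4n + 2m(2n+1))`. -/
theorem zeta_two_one_two_three_rational (m n : ℕ) :
    ∃ q : ℚ,
      MZV ((List.replicate n
              (List.replicate m 2 ++ [1] ++ List.replicate m 2 ++ [3])).flatten
            ++ List.replicate m 2)
        = q * Real.pi ^ (4 * n + 2 * m * (2 * n + 1)) := by
  obtain ⟨d, hd⟩ : ∃ d, (2 * m + 2) * (2 * n + 1) = d + 2 :=
    ⟨4 * n + 2 * m * (2 * n + 1), by ring⟩
  have hexp : 4 * n + 2 * m * (2 * n + 1) = d := by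
    have : (2 * m + 2) * (2 * n + 1) = 4 * n + 2 * m * (2 * n + 1) + 2 := by ring
    omega
  have h1 := mzvTail_mul_pi m n
  have h2 := iterInt_sparseWeight (by omega) hd
  rw [hd, show d + 2 - 1 = d + 1 by omega] at h1
  rw [← h1] at h2
  have h3 := congrArg ENNReal.toReal h2
  rw [ENNReal.toReal_mul, ENNReal.toReal_mul, ← MZV_eq_toReal, ENNReal.toReal_natCast,
    ENNReal.toReal_ofReal Real.pi_pos.le, ENNReal.toReal_ofReal (by positivity)] at h3
  refine ⟨1 / ((2 * n + 1 : ℕ) * (d + 1).factorial), ?_⟩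
  rw [hexp]
  have hpi := Real.pi_pos.ne'
  push_cast at h3 ⊢
  rw [pow_succ] at h3
  field_simp at h3 ⊢
  linear_combination h3
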